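/- arXiv:2402.18143 — 4 statements merged into one kernel-verified Lean document; each statement's English description precedes it below -/
import Mathlib

section
/- Let r̄ : [0,∞) → [0,∞) satisfy r̄(a) → 0 as a → ∞. Then there exists a sequence A : ℕ → [0,∞) with A(N) → 0 as N → ∞, depending only on r̄, with the following property: for every filtered probability space, every discrete-time martingale (M_k)_{k≥0} (with respect to the filtration) with M₀ = 0 whose increments Δ_k = M_k − M_{k−1} satisfy E[|Δ_k|·1_{{|Δ_k| > a}}] ≤ r̄(a) for all a ≥ 0 and all k ≥ 1, and every N ≥ 1, one has E[max_{0 ≤ k ≤ N} |M_k|] ≤ N·A(N). -/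
open MeasureTheory Filter

section MartingaleIncrements

variable {Ω : Type*} {m0 : MeasurableSpace Ω} {μ : Measure Ω}

theorem integral_mul_eq_zero_of_condExp_eq_zero [IsFiniteMeasure μ] {m : MeasurableSpace Ω}
    (hm : m ≤ m0) {X D : Ω → ℝ} {C : ℝ} (hX : StronglyMeasurable[m] X)
    (hXC : ∀ᵐ ω ∂μ, |X ω| ≤ C) (hD : Integrable D μ) (h0 : μ[D|m] =ᵐ[μ] 0) :
    ∫ ω, X ω * D ω ∂μ = 0 := by
  have hXD : Integrable (X * D) μ :=
    hD.bdd_mul (hX.mono hm).aestronglyMeasurable hXC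
  calc ∫ ω, X ω * D ω ∂μ = ∫ ω, (μ[X * D|m]) ω ∂μ := (integral_condExp hm).symm
    _ = ∫ _, (0 : ℝ) ∂μ := by
      refine integral_congr_ae ?_
      filter_upwards [condExp_mul_of_stronglyMeasurable_left hX hXD hD, h0] with ω h1 h2
      simp [h1, h2]
    _ = 0 := by simp

/-- A mean-zero increment is approximated in `L¹` by its truncated and recentred version. -/
theorem integral_abs_sub_centered_truncation_le {m : MeasurableSpace Ω}
    {X : Ω → ℝ} (hXm : StronglyMeasurable[m0] X) (hX : Integrable X μ) (h0 : μ[X|m] =ᵐ[μ] 0)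
    (a : ℝ) :
    ∫ ω, |X ω - ({ω | |X ω| ≤ a}.indicator X ω - (μ[{ω | |X ω| ≤ a}.indicator X|m]) ω)| ∂μ
      ≤ 2 * ∫ ω in {ω | a < |X ω|}, |X ω| ∂μ := by
  have hs : MeasurableSet[m0] {ω | a < |X ω|} :=
    stronglyMeasurable_const.measurableSet_lt (continuous_abs.comp_stronglyMeasurable hXm)
  have hcompl : {ω | |X ω| ≤ a} = {ω | a < |X ω|}ᶜ := by ext; simp
  set s := {ω | a < |X ω|} with hs_def
  rw [hcompl]
  have hU : Integrable (s.indicator X) μ := hX.indicator hs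
  have hT : Integrable (sᶜ.indicator X) μ := hX.indicator hs.compl
  have hsum : sᶜ.indicator X + s.indicator X = X := Set.indicator_compl_add_self s X
  have hUs : ∫ ω, |s.indicator X ω| ∂μ = ∫ ω in s, |X ω| ∂μ := by
    rw [← integral_indicator hs]
    congr 1 with ω
    by_cases h : ω ∈ s <;> simp [h]
  have hcond := condExp_add hT hU m
  rw [hsum] at hcond
  calc _ ≤ ∫ ω, (|s.indicator X ω| + |(μ[s.indicator X|m]) ω|) ∂μ := by
        refine integral_mono_of_nonneg (ae_of_all _ fun ω => abs_nonneg _)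
          (hU.abs.add integrable_condExp.abs) ?_
        filter_upwards [hcond, h0] with ω h1 h2
        have h3 := congrFun hsum ω
        simp only [Pi.add_apply, Pi.zero_apply] at h1 h2 h3
        have h4 : X ω - (sᶜ.indicator X ω - (μ[sᶜ.indicator X|m]) ω)
            = s.indicator X ω - (μ[s.indicator X|m]) ω := by linarith
        rw [h4]
        exact abs_sub _ _
    _ = ∫ ω, |s.indicator X ω| ∂μ + ∫ ω, |(μ[s.indicator X|m]) ω| ∂μ :=
        integral_add hU.abs integrable_condExp.abs
    _ ≤ 2 * ∫ ω in s, |X ω| ∂μ := by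
        have := integral_abs_condExp_le (μ := μ) (m := m) (s.indicator X)
        linarith

/-- Partial sums of a sequence of functions. -/
def incrementSum (D : ℕ → Ω → ℝ) (n : ℕ) (ω : Ω) : ℝ := ∑ j ∈ Finset.range n, D j ω

/-- Running maximum of the partial sums, started at the empty sum. -/
def incrementMax (D : ℕ → Ω → ℝ) : ℕ → Ω → ℝ
  | 0, _ => 0
  | n + 1, ω => max (incrementMax D n ω) (incrementSum D (n + 1) ω)

theorem incrementSum_succ (D : ℕ → Ω → ℝ) (n : ℕ) (ω : Ω) :
    incrementSum D (n + 1) ω = incrementSum D n ω + D n ω :=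
  Finset.sum_range_succ _ _

theorem incrementMax_nonneg (D : ℕ → Ω → ℝ) (n : ℕ) (ω : Ω) : 0 ≤ incrementMax D n ω := by
  induction n with
  | zero => exact le_rfl
  | succ n ih => exact ih.trans (le_max_left _ _)

theorem incrementSum_le_incrementMax (D : ℕ → Ω → ℝ) {k n : ℕ} (hkn : k ≤ n) (ω : Ω) :
    incrementSum D k ω ≤ incrementMax D n ω := by
  induction n with
  | zero =>
    obtain rfl : k = 0 := by lia
    simp [incrementSum, incrementMax]
  | succ n ih =>
    rcases Nat.lt_or_ge n k with h | h
    · obtain rfl : k = n + 1 := by lia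
      exact le_max_right _ _
    · exact (ih h).trans (le_max_left _ _)

/-- Pathwise form of Doob's `L²` maximal inequality. -/
theorem incrementMax_sq_le (D : ℕ → Ω → ℝ) (n : ℕ) (ω : Ω) :
    (incrementMax D n ω) ^ 2 ≤ 2 * (incrementMax D n ω * incrementSum D n ω
      - ∑ k ∈ Finset.range n, incrementMax D k ω * D k ω) := by
  induction n with
  | zero => simp [incrementMax]
  | succ n ih =>
    rw [Finset.sum_range_succ, incrementMax]
    have h : D n ω = incrementSum D (n + 1) ω - incrementSum D n ω := by
      rw [incrementSum_succ]; ring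
    rcases le_total (incrementMax D n ω) (incrementSum D (n + 1) ω) with h1 | h1
    · rw [max_eq_right h1, h]
      nlinarith [sq_nonneg (incrementSum D (n + 1) ω - incrementMax D n ω)]
    · rw [max_eq_left h1, h]
      nlinarith

variable {ℱ : Filtration ℕ m0} {D : ℕ → Ω → ℝ} {b : ℝ}

theorem stronglyMeasurable_incrementSum (hD : ∀ k, StronglyMeasurable[ℱ (k + 1)] (D k)) (n : ℕ) :
    StronglyMeasurable[ℱ n] (incrementSum D n) := by
  induction n with
  | zero =>
    have : incrementSum D 0 = fun _ => 0 := by ext; simp [incrementSum]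
    rw [this]; exact stronglyMeasurable_const
  | succ n ih =>
    have : incrementSum D (n + 1) = incrementSum D n + D n := by
      ext ω; exact incrementSum_succ D n ω
    rw [this]
    exact (ih.mono (ℱ.mono n.le_succ)).add (hD n)

theorem stronglyMeasurable_incrementMax (hD : ∀ k, StronglyMeasurable[ℱ (k + 1)] (D k)) (n : ℕ) :
    StronglyMeasurable[ℱ n] (incrementMax D n) := by
  induction n with
  | zero => exact stronglyMeasurable_const (b := (0 : ℝ))
  | succ n ih =>
    exact (continuous_fst.max continuous_snd).comp_stronglyMeasurable
      ((ih.mono (ℱ.mono n.le_succ)).prodMk (stronglyMeasurable_incrementSum hD (n + 1)))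

theorem abs_incrementSum_le (hb : ∀ k, ∀ᵐ ω ∂μ, |D k ω| ≤ b) (n : ℕ) :
    ∀ᵐ ω ∂μ, |incrementSum D n ω| ≤ n * b := by
  filter_upwards [ae_all_iff.2 hb] with ω h
  calc |incrementSum D n ω| ≤ ∑ j ∈ Finset.range n, |D j ω| := Finset.abs_sum_le_sum_abs _ _
    _ ≤ ∑ _j ∈ Finset.range n, b := Finset.sum_le_sum fun j _ => h j
    _ = n * b := by simp

theorem abs_incrementMax_le (hb0 : 0 ≤ b) (hb : ∀ k, ∀ᵐ ω ∂μ, |D k ω| ≤ b) (n : ℕ) :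
    ∀ᵐ ω ∂μ, |incrementMax D n ω| ≤ n * b := by
  filter_upwards [ae_all_iff.2 (abs_incrementSum_le hb)] with ω h
  rw [abs_of_nonneg (incrementMax_nonneg D n ω)]
  induction n with
  | zero => simp [incrementMax]
  | succ n ih =>
    refine max_le (ih.trans ?_) ((le_abs_self _).trans (h (n + 1)))
    push_cast; linarith

variable [IsProbabilityMeasure μ]

theorem integrable_mul_of_abs_le {X Y : Ω → ℝ} {C C' : ℝ} (hX : AEStronglyMeasurable X μ)
    (hY : AEStronglyMeasurable Y μ) (hXC : ∀ᵐ ω ∂μ, |X ω| ≤ C) (hYC : ∀ᵐ ω ∂μ, |Y ω| ≤ C') :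
    Integrable (fun ω => X ω * Y ω) μ :=
  (Integrable.of_bound hY C' hYC).bdd_mul hX hXC

theorem integral_incrementSum_sq_le (hD : ∀ k, StronglyMeasurable[ℱ (k + 1)] (D k))
    (hb : ∀ k, ∀ᵐ ω ∂μ, |D k ω| ≤ b) (h0 : ∀ k, μ[D k|ℱ k] =ᵐ[μ] 0) (n : ℕ) :
    ∫ ω, (incrementSum D n ω) ^ 2 ∂μ ≤ n * b ^ 2 := by
  have hDm : ∀ k, AEStronglyMeasurable (D k) μ := fun k =>
    ((hD k).mono (ℱ.le _)).aestronglyMeasurable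
  have hSm : ∀ k, AEStronglyMeasurable (incrementSum D k) μ := fun k =>
    ((stronglyMeasurable_incrementSum hD k).mono (ℱ.le _)).aestronglyMeasurable
  induction n with
  | zero => simp [incrementSum]
  | succ n ih =>
    have hSb := abs_incrementSum_le hb n
    have i1 : Integrable (fun ω => (incrementSum D n ω) ^ 2) μ := by
      simpa only [pow_two] using integrable_mul_of_abs_le (hSm n) (hSm n) hSb hSb
    have i2 : Integrable (fun ω => 2 * (incrementSum D n ω * D n ω)) μ :=
      (integrable_mul_of_abs_le (hSm n) (hDm n) hSb (hb n)).const_mul 2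
    have horth := integral_mul_eq_zero_of_condExp_eq_zero (ℱ.le n)
      (stronglyMeasurable_incrementSum hD n) hSb (Integrable.of_bound (hDm n) b (hb n)) (h0 n)
    calc ∫ ω, (incrementSum D (n + 1) ω) ^ 2 ∂μ
        ≤ ∫ ω, ((incrementSum D n ω) ^ 2 + 2 * (incrementSum D n ω * D n ω) + b ^ 2) ∂μ := by
          refine integral_mono_of_nonneg (ae_of_all _ fun ω => sq_nonneg _)
            ((i1.add i2).add (integrable_const _)) ?_
          filter_upwards [hb n] with ω h
          have := sq_le_sq' (abs_le.1 h).1 (abs_le.1 h).2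
          simp only [incrementSum_succ]
          nlinarith
      _ = ∫ ω, (incrementSum D n ω) ^ 2 ∂μ + b ^ 2 := by
          rw [integral_add (by exact i1.add i2) (integrable_const _), integral_add i1 i2,
            integral_const_mul, horth]
          simp
      _ ≤ (n + 1 : ℕ) * b ^ 2 := by push_cast; linarith

theorem integral_incrementMax_sq_le (hb0 : 0 ≤ b)
    (hD : ∀ k, StronglyMeasurable[ℱ (k + 1)] (D k))
    (hb : ∀ k, ∀ᵐ ω ∂μ, |D k ω| ≤ b) (h0 : ∀ k, μ[D k|ℱ k] =ᵐ[μ] 0) (n : ℕ) :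
    ∫ ω, (incrementMax D n ω) ^ 2 ∂μ ≤ 4 * (n * b ^ 2) := by
  have hDm : ∀ k, AEStronglyMeasurable (D k) μ := fun k =>
    ((hD k).mono (ℱ.le _)).aestronglyMeasurable
  have hSm : AEStronglyMeasurable (incrementSum D n) μ :=
    ((stronglyMeasurable_incrementSum hD n).mono (ℱ.le _)).aestronglyMeasurable
  have hRm : ∀ k, AEStronglyMeasurable (incrementMax D k) μ := fun k =>
    ((stronglyMeasurable_incrementMax hD k).mono (ℱ.le _)).aestronglyMeasurable
  have hSb := abs_incrementSum_le hb n
  have hRb := abs_incrementMax_le hb0 hb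
  have iS : Integrable (fun ω => (incrementSum D n ω) ^ 2) μ := by
    simpa only [pow_two] using integrable_mul_of_abs_le hSm hSm hSb hSb
  have iR : Integrable (fun ω => (incrementMax D n ω) ^ 2) μ := by
    simpa only [pow_two] using integrable_mul_of_abs_le (hRm n) (hRm n) (hRb n) (hRb n)
  have iD : ∀ k ∈ Finset.range n, Integrable (fun ω => incrementMax D k ω * D k ω) μ :=
    fun k _ => integrable_mul_of_abs_le (hRm k) (hDm k) (hRb k) (hb k)
  have key : ∫ ω, (incrementMax D n ω) ^ 2 ∂μ
      ≤ ∫ ω, (4 * (incrementSum D n ω) ^ 2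
        - 4 * ∑ k ∈ Finset.range n, incrementMax D k ω * D k ω) ∂μ := by
    refine integral_mono iR ((iS.const_mul 4).sub ((integrable_finsetSum _ iD).const_mul 4))
      fun ω => ?_
    have := incrementMax_sq_le D n ω
    simp only
    nlinarith [sq_nonneg (incrementMax D n ω - 2 * incrementSum D n ω)]
  rw [integral_sub (iS.const_mul 4) ((integrable_finsetSum _ iD).const_mul 4),
    integral_const_mul, integral_const_mul, integral_finsetSum _ iD,
    Finset.sum_eq_zero fun k _ => integral_mul_eq_zero_of_condExp_eq_zero (ℱ.le k)
      (stronglyMeasurable_incrementMax hD k) (hRb k) (Integrable.of_bound (hDm k) b (hb k))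
      (h0 k)] at key
  linarith [integral_incrementSum_sq_le hD hb h0 n]

theorem integrable_incrementMax (hb0 : 0 ≤ b)
    (hD : ∀ k, StronglyMeasurable[ℱ (k + 1)] (D k))
    (hb : ∀ k, ∀ᵐ ω ∂μ, |D k ω| ≤ b) (n : ℕ) : Integrable (incrementMax D n) μ :=
  Integrable.of_bound ((stronglyMeasurable_incrementMax hD n).mono (ℱ.le _)).aestronglyMeasurable
    _ (abs_incrementMax_le hb0 hb n)

theorem integral_incrementMax_le (hb0 : 0 ≤ b)
    (hD : ∀ k, StronglyMeasurable[ℱ (k + 1)] (D k))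
    (hb : ∀ k, ∀ᵐ ω ∂μ, |D k ω| ≤ b) (h0 : ∀ k, μ[D k|ℱ k] =ᵐ[μ] 0) (n : ℕ) :
    ∫ ω, incrementMax D n ω ∂μ ≤ 2 * (√n * b) := by
  have hvar := ProbabilityTheory.variance_nonneg (incrementMax D n) μ
  rw [ProbabilityTheory.variance_eq_sub (MemLp.of_bound
    ((stronglyMeasurable_incrementMax hD n).mono (ℱ.le _)).aestronglyMeasurable _
    (abs_incrementMax_le hb0 hb n))] at hvar
  have h := integral_incrementMax_sq_le hb0 hD hb h0 n
  refine abs_le_of_sq_le_sq' ?_ (by positivity) |>.2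
  rw [mul_pow, mul_pow, Real.sq_sqrt n.cast_nonneg]
  simp only [Pi.pow_apply] at hvar
  linarith

/-- Doob's maximal bound for a martingale with bounded increments plus an integrable remainder. -/
theorem integral_sup_abs_le_of_decomposition (hb0 : 0 ≤ b)
    (hD : ∀ k, StronglyMeasurable[ℱ (k + 1)] (D k))
    (hb : ∀ k, ∀ᵐ ω ∂μ, |D k ω| ≤ b) (h0 : ∀ k, μ[D k|ℱ k] =ᵐ[μ] 0)
    {M : ℕ → Ω → ℝ} (hM0 : ∀ ω, M 0 ω = 0)
    (hint : ∀ k, Integrable (M k) μ) {r : ℝ}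
    (hr : ∀ k, ∫ ω, |M (k + 1) ω - M k ω - D k ω| ∂μ ≤ r) (N : ℕ) :
    ∫ ω, (Finset.range (N + 1)).sup' Finset.nonempty_range_add_one (fun k => |M k ω|) ∂μ
      ≤ 4 * (√N * b) + N * r := by
  have hD' : ∀ k, StronglyMeasurable[ℱ (k + 1)] ((-D) k) := fun k => (hD k).neg
  have hb' : ∀ k, ∀ᵐ ω ∂μ, |(-D) k ω| ≤ b := fun k => by simpa using hb k
  have h0' : ∀ k, μ[(-D) k|ℱ k] =ᵐ[μ] 0 := fun k => by
    filter_upwards [condExp_neg (D k) (ℱ k) (μ := μ), h0 k] with ω h1 h2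
    simp only [Pi.neg_apply] at h1 ⊢
    simp [h1, h2]
  have i1 := integrable_incrementMax hb0 hD hb N (μ := μ)
  have i2 := integrable_incrementMax hb0 hD' hb' N (μ := μ)
  have iE : ∀ k ∈ Finset.range N, Integrable (fun ω => |M (k + 1) ω - M k ω - D k ω|) μ :=
    fun k _ => (((hint (k + 1)).sub (hint k)).sub (Integrable.of_bound
      ((hD k).mono (ℱ.le _)).aestronglyMeasurable b (hb k))).abs
  have hdec : ∀ ω k, M k ω = incrementSum D k ω
      + ∑ j ∈ Finset.range k, (M (j + 1) ω - M j ω - D j ω) := fun ω k => by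
    rw [Finset.sum_sub_distrib, Finset.sum_range_sub (fun j => M j ω), hM0, incrementSum]
    ring
  calc _ ≤ ∫ ω, (incrementMax D N ω + incrementMax (-D) N ω
        + ∑ j ∈ Finset.range N, |M (j + 1) ω - M j ω - D j ω|) ∂μ := by
        refine integral_mono_of_nonneg (ae_of_all _ fun ω => ?_)
          ((i1.add i2).add (integrable_finsetSum _ iE)) (ae_of_all _ fun ω => ?_)
        · exact (abs_nonneg (M 0 ω)).trans
            (Finset.le_sup' (fun k => |M k ω|) (Finset.mem_range.2 N.succ_pos))
        · refine Finset.sup'_le _ _ fun k hk => ?_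
          have hkN : k ≤ N := Nat.lt_succ_iff.1 (Finset.mem_range.1 hk)
          have e1 : |incrementSum D k ω| ≤ incrementMax D N ω + incrementMax (-D) N ω := by
            have a1 := incrementSum_le_incrementMax D hkN ω
            have a2 := incrementSum_le_incrementMax (-D) hkN ω
            have a3 : incrementSum (-D) k ω = -incrementSum D k ω := by simp [incrementSum]
            have a4 := incrementMax_nonneg D N ω
            have a5 := incrementMax_nonneg (-D) N ω
            exact abs_le.2 ⟨by linarith, by linarith⟩
          have e2 : |∑ j ∈ Finset.range k, (M (j + 1) ω - M j ω - D j ω)|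
              ≤ ∑ j ∈ Finset.range N, |M (j + 1) ω - M j ω - D j ω| :=
            (Finset.abs_sum_le_sum_abs _ _).trans (Finset.sum_le_sum_of_subset_of_nonneg
              (Finset.range_mono hkN) fun _ _ _ => abs_nonneg _)
          rw [hdec ω k]
          exact (abs_add_le _ _).trans (add_le_add e1 e2)
    _ = ∫ ω, incrementMax D N ω ∂μ + ∫ ω, incrementMax (-D) N ω ∂μ
        + ∑ j ∈ Finset.range N, ∫ ω, |M (j + 1) ω - M j ω - D j ω| ∂μ := by
        rw [integral_add (by exact i1.add i2) (integrable_finsetSum _ iE), integral_add i1 i2,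
          integral_finsetSum _ iE]
    _ ≤ 4 * (√N * b) + N * r := by
        have s1 := integral_incrementMax_le hb0 hD hb h0 N
        have s2 := integral_incrementMax_le hb0 hD' hb' h0' N
        have s3 : ∑ j ∈ Finset.range N, ∫ ω, |M (j + 1) ω - M j ω - D j ω| ∂μ ≤ N * r := by
          simpa using Finset.sum_le_sum (s := Finset.range N) fun j _ => hr j
        linarith

theorem integral_sup_abs_martingale_le {M : ℕ → Ω → ℝ} (hM : Martingale M ℱ μ)
    (hM0 : ∀ ω, M 0 ω = 0) {a r : ℝ} (ha : 0 ≤ a)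
    (hr : ∀ k, ∫ ω in {ω | a < |M (k + 1) ω - M k ω|}, |M (k + 1) ω - M k ω| ∂μ ≤ r) (N : ℕ) :
    ∫ ω, (Finset.range (N + 1)).sup' Finset.nonempty_range_add_one (fun k => |M k ω|) ∂μ
      ≤ 4 * (√N * (2 * a)) + N * (2 * r) := by
  set X : ℕ → Ω → ℝ := fun k ω => M (k + 1) ω - M k ω with hX
  have hXm : ∀ k, StronglyMeasurable[ℱ (k + 1)] (X k) := fun k =>
    (hM.stronglyAdapted (k + 1)).sub ((hM.stronglyAdapted k).mono (ℱ.mono k.le_succ))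
  have hXi : ∀ k, Integrable (X k) μ := fun k => (hM.integrable (k + 1)).sub (hM.integrable k)
  have hX0 : ∀ k, μ[X k|ℱ k] =ᵐ[μ] 0 := fun k => by
    have h := condExp_sub (hM.integrable (k + 1)) (hM.integrable k) (ℱ k)
    filter_upwards [h, hM.condExp_ae_eq k.le_succ, hM.condExp_ae_eq (le_refl k)] with ω h1 h2 h3
    have h4 : (μ[X k|ℱ k]) ω = (μ[M (k + 1) - M k|ℱ k]) ω := rfl
    rw [h4, h1, Pi.sub_apply, h2, h3]
    simp
  set T : ℕ → Ω → ℝ := fun k => {ω | |X k ω| ≤ a}.indicator (X k) with hT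
  have hTm : ∀ k, StronglyMeasurable[ℱ (k + 1)] (T k) := fun k =>
    (hXm k).indicator (StronglyMeasurable.measurableSet_le
      (continuous_abs.comp_stronglyMeasurable (hXm k)) stronglyMeasurable_const)
  have hTb : ∀ k ω, |T k ω| ≤ a := fun k ω => by
    by_cases h : |X k ω| ≤ a
    · simp [hT, h]
    · simpa only [hT, Set.indicator, Set.mem_ofPred_eq, h, if_false, abs_zero] using ha
  have hTi : ∀ k, Integrable (T k) μ := fun k =>
    Integrable.of_bound ((hTm k).mono (ℱ.le _)).aestronglyMeasurable a (ae_of_all _ (hTb k))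
  refine integral_sup_abs_le_of_decomposition (ℱ := ℱ) (D := fun k => T k - μ[T k|ℱ k])
    (by positivity) (fun k => (hTm k).sub (stronglyMeasurable_condExp.mono (ℱ.mono k.le_succ)))
    (fun k => ?_) (fun k => ?_) hM0 hM.integrable (fun k => ?_) N
  · have hc : ∀ᵐ ω ∂μ, |(μ[T k|ℱ k]) ω| ≤ a :=
      ae_bdd_abs_condExp_of_ae_bdd_abs (ae_of_all μ (hTb k))
    filter_upwards [hc] with ω h
    have := abs_sub (T k ω) ((μ[T k|ℱ k]) ω)
    simp only [Pi.sub_apply]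
    linarith [hTb k ω]
  · have h := condExp_sub (hTi k) (integrable_condExp (f := T k) (m := ℱ k)) (ℱ k)
    have h' := condExp_of_stronglyMeasurable (ℱ.le k)
      (stronglyMeasurable_condExp (f := T k) (m := ℱ k) (μ := μ)) integrable_condExp
    filter_upwards [h] with ω h1
    rw [h1, Pi.sub_apply, h']
    simp
  · exact (integral_abs_sub_centered_truncation_le ((hXm k).mono (ℱ.le _)) (hXi k)
      (hX0 k) a).trans (by linarith [hr k])

end MartingaleIncrements

open MeasureTheory Filter

/-- Uniform maximal estimate for discrete martingales with uniformly integrable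
increments: if `r̄(a) → 0` as `a → ∞`, there is a sequence `A(N) → 0`, depending only
on `r̄`, such that for every martingale `M` with `M₀ = 0` whose increments satisfy
`E[|Δ_k| 1_{|Δ_k| > a}] ≤ r̄(a)` for all `a ≥ 0` and `k ≥ 1`, one has
`E[max_{0 ≤ k ≤ N} |M_k|] ≤ N · A(N)` for every `N ≥ 1`. -/
theorem martingale_maximal_estimate
    (rbar : ℝ → ℝ) (hrbar_nonneg : ∀ x, 0 ≤ rbar x)
    (hrbar : Tendsto rbar atTop (nhds 0)) :
    ∃ A : ℕ → ℝ, (∀ N, 0 ≤ A N) ∧ Tendsto A atTop (nhds 0) ∧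
      ∀ (Ω : Type) [inst : MeasurableSpace Ω] (μ : Measure Ω)
        [IsProbabilityMeasure μ] (ℱ : Filtration ℕ inst) (M : ℕ → Ω → ℝ),
        Martingale M ℱ μ →
        (∀ ω, M 0 ω = 0) →
        (∀ k : ℕ, 1 ≤ k → ∀ a : ℝ, 0 ≤ a →
          (∫ ω in {ω | a < |M k ω - M (k - 1) ω|}, |M k ω - M (k - 1) ω| ∂μ)
            ≤ rbar a) →
        ∀ N : ℕ, 1 ≤ N →
          (∫ ω, (Finset.range (N + 1)).sup' Finset.nonempty_range_add_one
              (fun k => |M k ω|) ∂μ)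
            ≤ (N : ℝ) * A N := by

  have hlim : Tendsto (fun N : ℕ => √√(N : ℝ)) atTop atTop :=
    Real.tendsto_sqrt_atTop.comp (Real.tendsto_sqrt_atTop.comp tendsto_natCast_atTop_atTop)
  refine ⟨fun N => 8 / √√N + 2 * rbar √√N,
    fun N => add_nonneg (by positivity) (mul_nonneg zero_le_two (hrbar_nonneg _)), ?_, ?_⟩
  · simpa using (hlim.const_div_atTop 8).add ((hrbar.comp hlim).const_mul 2)
  · intro Ω inst μ _ ℱ M hM hM0 hr N hN
    refine (integral_sup_abs_martingale_le hM hM0 (Real.sqrt_nonneg √(N : ℝ)) (fun k => by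
      simpa using hr (k + 1) k.succ_pos _ (Real.sqrt_nonneg √(N : ℝ))) N).trans (le_of_eq ?_)
    have hN' : (0 : ℝ) < N := by exact_mod_cast hN
    have hpos : 0 < √√(N : ℝ) := by positivity
    have h1 : √√(N : ℝ) ^ 2 = √N := Real.sq_sqrt (Real.sqrt_nonneg _)
    have h2 : √(N : ℝ) ^ 2 = N := Real.sq_sqrt hN'.le
    have h3 : (N : ℝ) * (8 / √√(N : ℝ)) = 8 * √N * √√(N : ℝ) := by
      field_simp
      rw [h1, mul_comm, ← h2]
      norm_num [pow_two]
    rw [mul_add, h3]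
    ring
end

section
/- Let n ≥ 1 and ℓ ≥ 1 be integers, let x ∈ ℝ^n, and let y₀ < y₁ be reals. Set V = {i ∈ {1,…,n} : y₀ ≤ x_i < y₁}, P = #V, and Q = #{i ∈ {1,…,n} : x_i ≥ y₁}. Then Σ_{i ∈ V} (n − rank(i;x))^{ℓ−1} = Σ_{j=0}^{P−1} (Q + j)^{ℓ−1}. -/
open Finset

/-- The rank of index `i` in the vector `x`: the number of `j` with `x j < x i` plus the
number of `j ≤ i` with `x j = x i` (ties broken in favor of the smaller index). -/
noncomputable def rank (n : ℕ) (x : Fin n → ℝ) (i : Fin n) : ℕ :=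
  (Finset.univ.filter fun j => x j < x i).card +
  (Finset.univ.filter fun j => j ≤ i ∧ x j = x i).card

/-- The complementary rank of `i` counts the indices placed strictly after `i`. -/
theorem sub_rank_eq_card (n : ℕ) (x : Fin n → ℝ) (i : Fin n) :
    n - rank n x i =
      (Finset.univ.filter fun j => x i < x j ∨ (x j = x i ∧ i < j)).card := by
  have hdisj : Disjoint (Finset.univ.filter fun j => x j < x i)
      (Finset.univ.filter fun j => j ≤ i ∧ x j = x i) := by
    rw [Finset.disjoint_filter]
    rintro j - h ⟨-, h'⟩
    exact h.ne h'
  have hcompl : (Finset.univ.filter fun j => x i < x j ∨ (x j = x i ∧ i < j)) =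
      ((Finset.univ.filter fun j => x j < x i) ∪
        (Finset.univ.filter fun j => j ≤ i ∧ x j = x i))ᶜ := by
    ext j
    simp only [Finset.mem_filter, Finset.mem_univ, true_and, Finset.mem_compl, Finset.mem_union]
    grind
  rw [hcompl, Finset.card_compl, Finset.card_union_of_disjoint hdisj, Fintype.card_fin, rank]

/-- An index placed after `i` has a strictly smaller complementary rank. -/
theorem sub_rank_lt_sub_rank {n : ℕ} {x : Fin n → ℝ} {i k : Fin n}
    (h : x i < x k ∨ (x k = x i ∧ i < k)) : n - rank n x k < n - rank n x i := by
  rw [sub_rank_eq_card, sub_rank_eq_card]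
  refine Finset.card_lt_card (Finset.ssubset_iff_of_subset ?_ |>.2 ⟨k, ?_, ?_⟩)
  · intro j
    simp only [Finset.mem_filter, Finset.mem_univ, true_and]
    grind
  · simpa using h
  · simp

theorem sub_rank_injective (n : ℕ) (x : Fin n → ℝ) :
    Function.Injective fun i => n - rank n x i := by
  intro i k h
  by_contra hne
  have hcases : (x i < x k ∨ (x k = x i ∧ i < k)) ∨ (x k < x i ∨ (x i = x k ∧ k < i)) := by
    grind
  rcases hcases with h' | h'
  · exact (sub_rank_lt_sub_rank h').ne' h
  · exact (sub_rank_lt_sub_rank h').ne h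

/-- The complementary ranks of the indices with values in `[y₀, y₁)` form an interval. -/
theorem image_sub_rank (n : ℕ) (x : Fin n → ℝ) (y₀ y₁ : ℝ) :
    (Finset.univ.filter fun i => y₀ ≤ x i ∧ x i < y₁).image (fun i => n - rank n x i) =
      Finset.Ico (Finset.univ.filter fun i => y₁ ≤ x i).card
        ((Finset.univ.filter fun i => y₁ ≤ x i).card +
          (Finset.univ.filter fun i => y₀ ≤ x i ∧ x i < y₁).card) := by
  refine Finset.eq_of_subset_of_card_le ?_ ?_
  · refine Finset.image_subset_iff.2 fun i hi => ?_
    simp only [Finset.mem_filter, Finset.mem_univ, true_and] at hi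
    rw [Finset.mem_Ico, sub_rank_eq_card]
    constructor
    · refine Finset.card_le_card fun j => ?_
      simp only [Finset.mem_filter, Finset.mem_univ, true_and]
      exact fun hj => Or.inl (hi.2.trans_le hj)
    · refine lt_of_lt_of_le (Finset.card_lt_card ?_) (Finset.card_union_le _ _)
      refine Finset.ssubset_iff_of_subset ?_ |>.2 ⟨i, ?_, ?_⟩
      · intro j
        simp only [Finset.mem_filter, Finset.mem_univ, true_and, Finset.mem_union]
        grind
      · simp [hi]
      · simp
  · rw [Finset.card_image_of_injective _ (sub_rank_injective n x), Nat.card_Ico,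
      Nat.add_sub_cancel_left]

/-- The complementary ranks of the indices falling in `[y₀, y₁)` are exactly
`Q, Q+1, …, Q+P−1`, where `P` is the number of such indices and `Q` the number of
indices with `x i ≥ y₁`; hence the sum of their `(ℓ−1)`-th powers equals
`Σ_{j=0}^{P−1} (Q+j)^{ℓ−1}`. -/
theorem sum_complementary_rank_pow
    (n ℓ : ℕ) (hn : 1 ≤ n) (hℓ : 1 ≤ ℓ) (x : Fin n → ℝ) (y₀ y₁ : ℝ) (hy : y₀ < y₁) :
    ∑ i ∈ Finset.univ.filter (fun i => y₀ ≤ x i ∧ x i < y₁),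
        (n - rank n x i) ^ (ℓ - 1)
      = ∑ j ∈ Finset.range
            ((Finset.univ.filter fun i => y₀ ≤ x i ∧ x i < y₁).card),
          ((Finset.univ.filter fun i => y₁ ≤ x i).card + j) ^ (ℓ - 1) := by
  rw [← Finset.sum_image (f := fun m => m ^ (ℓ - 1)) (sub_rank_injective n x).injOn,
    image_sub_rank, Finset.sum_Ico_eq_sum_range, Nat.add_sub_cancel_left]
end

section
/- Let ℓ ≥ 2 be an integer, let μ be a Borel probability measure on [0,∞), and let g : [0,∞) → ℝ be continuously differentiable with compact support and g(0) = 0. Then ∫_{[0,∞)} g(x)·𝔖(μ([x,∞)), μ((x,∞))) dμ(x) = ∫₀^∞ g'(x)·μ((x,∞))^ℓ dx, where the right-hand integral is with respect to Lebesgue measure. -/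
open MeasureTheory Set

/-- `𝔖(s,t) = Σ_{j=0}^{ℓ−1} s^{ℓ−1−j} t^j`, so that `(s−t)𝔖(s,t) = s^ℓ − t^ℓ` and
`𝔖(s,s) = ℓ s^{ℓ−1}`. -/
noncomputable def frakS (ℓ : ℕ) (s t : ℝ) : ℝ :=
  ∑ j ∈ Finset.range ℓ, s ^ (ℓ - 1 - j) * t ^ j

theorem frakS_succ (ℓ : ℕ) (s t : ℝ) : frakS (ℓ + 1) s t = s * frakS ℓ s t + t ^ ℓ := by
  unfold frakS
  rw [Finset.sum_range_succ, Finset.mul_sum]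
  congr 1
  · refine Finset.sum_congr rfl fun j hj => ?_
    have hj' : ℓ + 1 - 1 - j = (ℓ - 1 - j) + 1 := by
      have := Finset.mem_range.1 hj
      omega
    rw [hj']
    ring
  · simp

theorem abs_frakS_le (ℓ : ℕ) {s t : ℝ} (hs0 : 0 ≤ s) (hs1 : s ≤ 1) (ht0 : 0 ≤ t) (ht1 : t ≤ 1) :
    |frakS ℓ s t| ≤ ℓ := by
  unfold frakS
  rw [abs_of_nonneg (Finset.sum_nonneg fun j _ => by positivity)]
  calc ∑ j ∈ Finset.range ℓ, s ^ (ℓ - 1 - j) * t ^ j ≤ ∑ j ∈ Finset.range ℓ, (1 : ℝ) :=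
        Finset.sum_le_sum fun j _ => mul_le_one₀ (pow_le_one₀ hs0 hs1) (pow_nonneg ht0 _)
          (pow_le_one₀ ht0 ht1)
    _ = ℓ := by simp

theorem measurable_toReal_measure_Ioi (μ : Measure ℝ) [IsProbabilityMeasure μ] :
    Measurable fun x => (μ (Ioi x)).toReal :=
  Antitone.measurable fun _ _ hxy =>
    ENNReal.toReal_mono (measure_ne_top _ _) (measure_mono (Ioi_subset_Ioi hxy))

theorem measurable_toReal_measure_Ici (μ : Measure ℝ) [IsProbabilityMeasure μ] :
    Measurable fun x => (μ (Ici x)).toReal :=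
  Antitone.measurable fun _ _ hxy =>
    ENNReal.toReal_mono (measure_ne_top _ _) (measure_mono (Ici_subset_Ici.2 hxy))

theorem integrable_frakS_tail (ℓ : ℕ) (μ : Measure ℝ) [IsProbabilityMeasure μ] :
    Integrable (fun x => frakS ℓ (μ (Ici x)).toReal (μ (Ioi x)).toReal) μ := by
  refine Integrable.of_bound (C := ℓ) (Measurable.aestronglyMeasurable ?_) (ae_of_all _ fun x => ?_)
  · unfold frakS
    exact Finset.measurable_sum _ fun j _ => ((measurable_toReal_measure_Ici μ).pow_const _).mul
      ((measurable_toReal_measure_Ioi μ).pow_const _)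
  · exact abs_frakS_le ℓ ENNReal.toReal_nonneg measureReal_le_one ENNReal.toReal_nonneg
      measureReal_le_one

theorem integral_mul_setIntegral_swap {α β : Type*} [MeasurableSpace α] [MeasurableSpace β]
    {μ : Measure α} {ν : Measure β} [SFinite μ] [SFinite ν] {S : Set (α × β)}
    (hS : MeasurableSet S) {w : α → ℝ} {h : β → ℝ} (hw : Integrable w μ) (hh : Integrable h ν) :
    ∫ x, w x * ∫ y in {y | (x, y) ∈ S}, h y ∂ν ∂μ
      = ∫ y, h y * ∫ x in {x | (x, y) ∈ S}, w x ∂μ ∂ν := by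
  have key := integral_integral_swap (μ := μ) (ν := ν)
    (f := fun x y => S.indicator (fun p => w p.1 * h p.2) (x, y)) ((hw.mul_prod hh).indicator hS)
  have hx (x : α) : ∫ y, S.indicator (fun p => w p.1 * h p.2) (x, y) ∂ν
      = w x * ∫ y in {y | (x, y) ∈ S}, h y ∂ν := by
    rw [← integral_const_mul]
    exact integral_indicator (measurable_prodMk_left hS)
  have hy (y : β) : ∫ x, S.indicator (fun p => w p.1 * h p.2) (x, y) ∂μ
      = h y * ∫ x in {x | (x, y) ∈ S}, w x ∂μ := by
    rw [mul_comm, ← integral_mul_const]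
    exact integral_indicator (measurable_prodMk_right hS)
  simpa only [hx, hy] using key

theorem setIntegral_Ioi_frakS_tail (ℓ : ℕ) (hℓ : 1 ≤ ℓ) (μ : Measure ℝ) [IsProbabilityMeasure μ]
    (a : ℝ) :
    ∫ x in Ioi a, frakS ℓ (μ (Ici x)).toReal (μ (Ioi x)).toReal ∂μ
      = (μ (Ioi a)).toReal ^ ℓ := by
  induction ℓ, hℓ using Nat.le_induction generalizing a with
  | base => simp [frakS, Measure.real]
  | succ ℓ _ ih =>
    set F : ℝ → ℝ := fun x => frakS ℓ (μ (Ici x)).toReal (μ (Ioi x)).toReal with hF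
    have hFint : Integrable F μ := integrable_frakS_tail ℓ μ
    have hpow : Integrable (fun x => (μ (Ioi x)).toReal ^ ℓ) μ := by
      refine Integrable.of_bound (C := 1)
        ((measurable_toReal_measure_Ioi μ).pow_const _).aestronglyMeasurable
        (ae_of_all _ fun x => ?_)
      rw [Real.norm_of_nonneg (by positivity)]
      exact pow_le_one₀ ENNReal.toReal_nonneg measureReal_le_one
    have hsF : ∫ x in Ioi a, (μ (Ici x)).toReal * F x ∂μ
        = ∫ y in Ioi a, ((μ (Ioi a)).toReal ^ ℓ - (μ (Ioi y)).toReal ^ ℓ) ∂μ := by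
      have swap := integral_mul_setIntegral_swap (μ := μ.restrict (Ioi a))
        (ν := μ.restrict (Ioi a)) (S := {p : ℝ × ℝ | p.1 ≤ p.2})
        (measurableSet_le measurable_fst measurable_snd) hFint.restrict
        (integrable_const (1 : ℝ))
      simp only [one_mul] at swap
      convert swap using 1
      · refine setIntegral_congr_fun measurableSet_Ioi fun x hx => ?_
        have hsub : Ici x ∩ Ioi a = Ici x := inter_eq_left.2 (Ici_subset_Ioi.2 hx)
        change _ = F x * ∫ y in Ici x, (1 : ℝ) ∂(μ.restrict (Ioi a))
        rw [Measure.restrict_restrict measurableSet_Ici, hsub]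
        simp [Measure.real, mul_comm]
      · refine setIntegral_congr_fun measurableSet_Ioi fun y hy => ?_
        change _ = ∫ x in Iic y, F x ∂(μ.restrict (Ioi a))
        rw [Measure.restrict_restrict measurableSet_Iic, inter_comm, Ioi_inter_Iic]
        have hsplit := setIntegral_union (μ := μ) (f := F) (Ioc_disjoint_Ioi_same (a := a) (b := y))
          measurableSet_Ioi hFint.integrableOn hFint.integrableOn
        rw [Ioc_union_Ioi_eq_Ioi (le_of_lt hy), hF, ih a, ih y] at hsplit
        exact sub_eq_of_eq_add hsplit
    have hsFint : Integrable (fun x => (μ (Ici x)).toReal * F x) μ := by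
      refine hFint.bdd_mul (c := 1) (measurable_toReal_measure_Ici μ).aestronglyMeasurable
        (ae_of_all _ fun x => ?_)
      rw [Real.norm_of_nonneg ENNReal.toReal_nonneg]
      exact measureReal_le_one
    simp only [frakS_succ]
    rw [integral_add hsFint.restrict hpow.restrict, hsF,
      integral_sub (integrable_const _) hpow.restrict]
    simp [Measure.real, pow_succ, mul_comm]

/-- Integration-by-parts identity: for a Borel probability measure `μ` on `[0,∞)` and a
`C¹` compactly supported `g` with `g(0) = 0`,
`∫ g(x) 𝔖(μ[x,∞), μ(x,∞)) dμ(x) = ∫₀^∞ g'(x) μ(x,∞)^ℓ dx`. -/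
theorem integral_frakS_eq_integral_tail_pow
    (ℓ : ℕ) (hℓ : 2 ≤ ℓ) (μ : Measure ℝ) [IsProbabilityMeasure μ]
    (hμ : μ (Iio 0) = 0)
    (g : ℝ → ℝ) (hg : ContDiff ℝ 1 g) (hgsupp : HasCompactSupport g)
    (hg0 : g 0 = 0) :
    ∫ x, g x * frakS ℓ (μ (Ici x)).toReal (μ (Ioi x)).toReal ∂μ
      = ∫ x in Ici (0:ℝ), deriv g x * (μ (Ioi x)).toReal ^ ℓ := by
  have hg' : Continuous (deriv g) := hg.continuous_deriv le_rfl
  have hint : Integrable (deriv g) := hg'.integrable_of_hasCompactSupport hgsupp.deriv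
  have swap := integral_mul_setIntegral_swap (μ := μ) (ν := volume.restrict (Ici (0 : ℝ)))
    (S := {p : ℝ × ℝ | p.2 < p.1}) (measurableSet_lt measurable_snd measurable_fst)
    (integrable_frakS_tail ℓ μ) hint.restrict
  have hnonneg : ∀ᵐ x ∂μ, 0 ≤ x := by
    rw [ae_iff]
    simp only [not_le]
    exact hμ
  convert swap using 1
  · refine integral_congr_ae (hnonneg.mono fun x hx => ?_)
    change _ = _ * ∫ y in Iio x, deriv g y ∂(volume.restrict (Ici 0))
    have hftc := intervalIntegral.integral_deriv_eq_sub (f := g) (a := 0) (b := x)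
      (fun y _ => hg.differentiable one_ne_zero y) (hg'.intervalIntegrable 0 x)
    rw [hg0, sub_zero, intervalIntegral.integral_of_le hx, ← integral_Ico_eq_integral_Ioc] at hftc
    rw [Measure.restrict_restrict measurableSet_Iio, inter_comm, Ici_inter_Iio, hftc, mul_comm]
  · refine integral_congr_ae (ae_of_all _ fun y => ?_)
    exact congrArg (deriv g y * ·) (setIntegral_Ioi_frakS_tail ℓ (by omega) μ y).symm
end

section
/- Let ℓ ≥ 2 be an integer. For each n ≥ 1 let x^n ∈ [0,∞)^n, and suppose the empirical measures μ_n = n^{−1} Σ_{i=1}^n δ_{x^n_i} converge weakly, as n → ∞, to a Borel probability measure μ on [0,∞). Let g : [0,∞) → ℝ be continuous with compact support. Then n^{−1} Σ_{i=1}^n g(x^n_i)·((n − rank(i;x^n))/n)^{ℓ−1} → (1/ℓ) ∫_{[0,∞)} g(x)·𝔖(μ([x,∞)), μ((x,∞))) dμ(x) as n → ∞. -/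
open MeasureTheory Set Filter

open scoped ENNReal Topology

section Tail

variable {α : Type*} [LinearOrder α] [TopologicalSpace α] [OrderTopology α]
  [MeasurableSpace α] [BorelSpace α]

lemma measurable_measure_Ici (μ : Measure α) : Measurable fun a => μ (Ici a) :=
  Antitone.measurable fun _ _ h => measure_mono (Ici_subset_Ici.2 h)

lemma measurable_measure_Ioi (μ : Measure α) : Measurable fun a => μ (Ioi a) :=
  Antitone.measurable fun _ _ h => measure_mono (Ioi_subset_Ioi h)

end Tail

section MinLaw

variable {α : Type*} [LinearOrder α] [TopologicalSpace α] [OrderTopology α]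
  [SecondCountableTopology α] [MeasurableSpace α] [BorelSpace α]

/-- The law of the minimum of `k + 1` independent samples from `μ`. -/
noncomputable def minLaw (μ : ProbabilityMeasure α) : ℕ → ProbabilityMeasure α
  | 0 => μ
  | k + 1 => ((minLaw μ k).prod μ).map
      (f := fun p : α × α => min p.1 p.2) (measurable_fst.min measurable_snd).aemeasurable

lemma toMeasure_minLaw_succ (μ : ProbabilityMeasure α) (k : ℕ) :
    (minLaw μ (k + 1) : Measure α) =
      ((minLaw μ k : Measure α).prod (μ : Measure α)).map (fun p => min p.1 p.2) := rfl

lemma minLaw_Ioi (μ : ProbabilityMeasure α) (k : ℕ) (a : α) :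
    (minLaw μ k : Measure α) (Ioi a) = (μ : Measure α) (Ioi a) ^ (k + 1) := by
  induction k with
  | zero => simp [minLaw]
  | succ k ih =>
    have hpre : (fun p : α × α => min p.1 p.2) ⁻¹' Ioi a = Ioi a ×ˢ Ioi a := by
      ext p; simp
    rw [toMeasure_minLaw_succ, Measure.map_apply (by fun_prop) measurableSet_Ioi, hpre,
      Measure.prod_prod, ih, ← pow_succ]

/-- Splitting according to which of two independent variables attains the minimum. -/
lemma lintegral_map_min_prod (ν μ : Measure α) [IsFiniteMeasure ν] [IsFiniteMeasure μ]
    {f : α → ℝ≥0∞} (hf : Measurable f) :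
    ∫⁻ y, f y ∂((ν.prod μ).map fun p => min p.1 p.2) =
      ∫⁻ y, f y * ν (Ioi y) ∂μ + ∫⁻ y, f y * μ (Ici y) ∂ν := by
  have hlt : MeasurableSet {p : α × α | p.2 < p.1} := measurableSet_lt measurable_snd measurable_fst
  have hle : MeasurableSet {p : α × α | p.1 ≤ p.2} := measurableSet_le measurable_fst measurable_snd
  rw [lintegral_map hf (by fun_prop)]
  have hsplit : ∀ p : α × α, f (min p.1 p.2) =
      {p : α × α | p.2 < p.1}.indicator (fun p => f p.2) p +
      {p : α × α | p.1 ≤ p.2}.indicator (fun p => f p.1) p := by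
    intro p
    rcases lt_or_ge p.2 p.1 with h | h
    · simp [h, h.le]
    · simp [h]
  simp_rw [hsplit]
  have hm₁ : Measurable ({p : α × α | p.2 < p.1}.indicator (fun p => f p.2)) :=
    (hf.comp measurable_snd).indicator hlt
  have hm₂ : Measurable ({p : α × α | p.1 ≤ p.2}.indicator (fun p => f p.1)) :=
    (hf.comp measurable_fst).indicator hle
  rw [lintegral_add_left hm₁, lintegral_prod_symm' _ hm₁, lintegral_prod _ hm₂.aemeasurable]
  congr 1
  · refine lintegral_congr fun y => ?_
    have : (fun x => {p : α × α | p.2 < p.1}.indicator (fun p => f p.2) (x, y)) =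
        (Ioi y).indicator fun _ => f y := by
      ext x; simp [indicator]
    rw [this, lintegral_indicator_const measurableSet_Ioi]
  · refine lintegral_congr fun x => ?_
    have : (fun y => {p : α × α | p.1 ≤ p.2}.indicator (fun p => f p.1) (x, y)) =
        (Ici x).indicator fun _ => f x := by
      ext y; simp [indicator]
    rw [this, lintegral_indicator_const measurableSet_Ici]

lemma lintegral_minLaw (μ : ProbabilityMeasure α) (k : ℕ) {f : α → ℝ≥0∞} (hf : Measurable f) :
    ∫⁻ y, f y ∂(minLaw μ k : Measure α) =
      ∫⁻ y, f y * ∑ j ∈ Finset.range (k + 1),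
        (μ : Measure α) (Ici y) ^ (k - j) * (μ : Measure α) (Ioi y) ^ j ∂(μ : Measure α) := by
  induction k generalizing f with
  | zero => simp [minLaw]
  | succ k ih =>
    have hI := measurable_measure_Ici (μ : Measure α)
    rw [toMeasure_minLaw_succ, lintegral_map_min_prod _ _ hf, ih (f := fun y => f y * (μ : Measure α) (Ici y)) (hf.mul hI),
      ← lintegral_add_left (f := fun y => f y * (minLaw μ k : Measure α) (Ioi y))
        (hf.mul (measurable_measure_Ioi _))]
    refine lintegral_congr fun y => ?_
    rw [minLaw_Ioi, Finset.sum_range_succ _ (k + 1), mul_add, add_comm, Finset.mul_sum,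
      Finset.mul_sum]
    congr 1
    · refine Finset.sum_congr rfl fun j hj => ?_
      rw [show k + 1 - j = k - j + 1 by have := Finset.mem_range.1 hj; omega]
      ring
    · simp

lemma integral_minLaw (μ : ProbabilityMeasure α) (k : ℕ) (f : α → ℝ) :
    ∫ y, f y ∂(minLaw μ k : Measure α) =
      ∫ y, f y * frakS (k + 1) ((μ : Measure α) (Ici y)).toReal
        ((μ : Measure α) (Ioi y)).toReal ∂(μ : Measure α) := by
  set d : α → ℝ≥0∞ := fun y => ∑ j ∈ Finset.range (k + 1),
    (μ : Measure α) (Ici y) ^ (k - j) * (μ : Measure α) (Ioi y) ^ j with hd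
  have hI := measurable_measure_Ici (μ : Measure α)
  have hJ := measurable_measure_Ioi (μ : Measure α)
  have hdm : Measurable d := by fun_prop
  have hfin : ∀ y, ∀ j ∈ Finset.range (k + 1),
      (μ : Measure α) (Ici y) ^ (k - j) * (μ : Measure α) (Ioi y) ^ j ≠ ∞ := fun y j _ =>
    ENNReal.mul_ne_top (ENNReal.pow_ne_top (measure_ne_top _ _))
      (ENNReal.pow_ne_top (measure_ne_top _ _))
  have hdens : (minLaw μ k : Measure α) = (μ : Measure α).withDensity d := by
    refine Measure.ext_of_lintegral _ fun f hf => ?_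
    rw [lintegral_minLaw μ k hf, lintegral_withDensity_eq_lintegral_mul _ hdm hf]
    exact lintegral_congr fun y => mul_comm _ _
  rw [hdens, integral_withDensity_eq_integral_toReal_smul hdm
    (Eventually.of_forall fun y => (ENNReal.sum_ne_top.2 (hfin y)).lt_top)]
  refine integral_congr_ae (Eventually.of_forall fun y => ?_)
  simp only [hd, ENNReal.toReal_sum (hfin y), smul_eq_mul, frakS, ENNReal.toReal_mul,
    ENNReal.toReal_pow, Nat.add_sub_cancel]
  exact mul_comm _ _

lemma map_minLaw {β : Type*} [LinearOrder β] [TopologicalSpace β] [OrderTopology β]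
    [SecondCountableTopology β] [MeasurableSpace β] [BorelSpace β]
    (μ : ProbabilityMeasure α) {z : α → β} (hz : Monotone z) (hzm : Measurable z) (k : ℕ) :
    (minLaw μ k).map hzm.aemeasurable = minLaw (μ.map hzm.aemeasurable) k := by
  induction k with
  | zero => rfl
  | succ k ih =>
    apply Subtype.ext
    change (minLaw μ (k + 1) : Measure α).map z =
      (minLaw (μ.map hzm.aemeasurable) (k + 1) : Measure β)
    rw [toMeasure_minLaw_succ, toMeasure_minLaw_succ, ← ih]
    change _ = Measure.map _ (((minLaw μ k : Measure α).map z).prod ((μ : Measure α).map z))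
    rw [Measure.map_prod_map _ _ hzm hzm, Measure.map_map hzm (by fun_prop),
      Measure.map_map (by fun_prop) (by fun_prop)]
    congr 1
    ext p
    exact hz.map_min

lemma continuous_minLaw (k : ℕ) :
    Continuous fun μ : ProbabilityMeasure α => minLaw μ k := by
  induction k with
  | zero => exact continuous_id
  | succ k ih =>
    exact (ProbabilityMeasure.continuous_map (f := fun p : α × α => min p.1 p.2)
      (continuous_fst.min continuous_snd)).comp
        (ProbabilityMeasure.continuous_prod.comp (ih.prodMk continuous_id))

end MinLaw

lemma rank_sort {n : ℕ} (x : Fin n → ℝ) (k : Fin n) :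
    rank n x (Tuple.sort x k) = k + 1 := by
  obtain ⟨hmono, htie⟩ := Tuple.eq_sort_iff.1 (rfl : Tuple.sort x = Tuple.sort x)
  set σ := Tuple.sort x
  have key : ∀ m : Fin n, (x (σ m) < x (σ k) ∨ σ m ≤ σ k ∧ x (σ m) = x (σ k)) ↔ m ≤ k := by
    intro m
    rcases lt_trichotomy m k with h | rfl | h
    · have := hmono h.le
      have h2 := htie m k h
      simp only [Function.comp_apply] at this
      rcases this.lt_or_eq with h3 | h3
      · simp [h3, h.le]
      · simp [h3, (h2 h3).le, h.le]
    · simp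
    · have := hmono h.le
      have h2 := htie k m h
      simp only [Function.comp_apply] at this
      simp only [not_lt.2 this, h.not_ge, false_or, iff_false, not_and]
      intro h3 h4
      exact (h2 h4.symm).not_ge h3
  unfold rank
  rw [← Finset.card_union_of_disjoint, ← Finset.filter_or,
    show k.val + 1 = (Finset.Iic k).card by simp]
  · symm
    refine Finset.card_bij (fun m _ => σ m) ?_ ?_ ?_
    · intro m hm
      simpa using (key m).2 (Finset.mem_Iic.1 hm)
    · intro a _ b _ h
      exact σ.injective h
    · intro j hj
      refine ⟨σ.symm j, Finset.mem_Iic.2 ((key _).1 ?_), by simp⟩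
      simpa using hj
  · exact Finset.disjoint_filter.2 fun j _ h1 h2 => h1.ne h2.2

lemma abs_frakS_sub_le (k : ℕ) {s t : ℝ} (ht : 0 ≤ t) (hts : t ≤ s) (hs : s ≤ 1) :
    |frakS (k + 1) s t - (k + 1) * t ^ k| ≤ (k + 1) * (k * (s - t)) := by
  have hs0 : 0 ≤ s := ht.trans hts
  have hpow : s ^ k - t ^ k ≤ k * (s - t) := by
    have h := (Commute.all s t).geom_sum₂_mul k
    rw [← h]
    refine mul_le_mul_of_nonneg_right ?_ (sub_nonneg.2 hts)
    calc _ ≤ ∑ i ∈ Finset.range k, (1 : ℝ) := Finset.sum_le_sum fun i _ =>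
          mul_le_one₀ (pow_le_one₀ hs0 hs) (by positivity) (pow_le_one₀ ht (hts.trans hs))
      _ = k := by simp
  have hterm : ∀ j ∈ Finset.range (k + 1),
      |s ^ (k - j) * t ^ j - t ^ k| ≤ k * (s - t) := by
    intro j hj
    have hj' : k - j + j = k := by have := Finset.mem_range.1 hj; omega
    have h1 : t ^ k ≤ s ^ (k - j) * t ^ j := by
      nth_rw 1 [← hj', pow_add]; gcongr
    have h2 : s ^ (k - j) * t ^ j ≤ s ^ k := by
      calc s ^ (k - j) * t ^ j ≤ s ^ (k - j) * s ^ j := by gcongr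
        _ = s ^ k := by rw [← pow_add, hj']
    rw [abs_of_nonneg (by linarith)]
    linarith
  have : frakS (k + 1) s t - (k + 1) * t ^ k =
      ∑ j ∈ Finset.range (k + 1), (s ^ (k - j) * t ^ j - t ^ k) := by
    simp [frakS, Finset.sum_sub_distrib]
  rw [this]
  refine (Finset.abs_sum_le_sum_abs _ _).trans ((Finset.sum_le_sum hterm).trans ?_)
  simp

/-- The uniform distribution on `Fin (n + 1)`. -/
noncomputable def uniformFin (n : ℕ) : ProbabilityMeasure (Fin (n + 1)) :=
  ⟨(PMF.uniformOfFintype (Fin (n + 1))).toMeasure, inferInstance⟩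

lemma integral_uniformFin (n : ℕ) (f : Fin (n + 1) → ℝ) :
    ∫ i, f i ∂(uniformFin n : Measure (Fin (n + 1))) = ((n : ℝ) + 1)⁻¹ * ∑ i, f i := by
  change ∫ i, f i ∂(PMF.uniformOfFintype (Fin (n + 1))).toMeasure = _
  rw [PMF.integral_eq_sum, Finset.mul_sum]
  refine Finset.sum_congr rfl fun i _ => ?_
  simp [ENNReal.toReal_add]

lemma uniformFin_apply (n : ℕ) (s : Finset (Fin (n + 1))) :
    ((uniformFin n : Measure (Fin (n + 1))) s).toReal = s.card / ((n : ℝ) + 1) := by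
  change ((PMF.uniformOfFintype (Fin (n + 1))).toMeasure s).toReal = _
  rw [PMF.toMeasure_uniformOfFintype_apply _ s.measurableSet]
  simp [ENNReal.toReal_add]

/-- The empirical measure of a nonempty tuple. -/
noncomputable def empiricalLaw {n : ℕ} (x : Fin (n + 1) → ℝ) : ProbabilityMeasure ℝ :=
  (uniformFin n).map (f := x) (measurable_of_finite x).aemeasurable

lemma integral_empiricalLaw {n : ℕ} (x : Fin (n + 1) → ℝ) {f : ℝ → ℝ} (hf : Measurable f) :
    ∫ y, f y ∂(empiricalLaw x : Measure ℝ) = ((n : ℝ) + 1)⁻¹ * ∑ i, f (x i) := by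
  change ∫ y, f y ∂((uniformFin n : Measure (Fin (n + 1))).map x) = _
  rw [integral_map (measurable_of_finite x).aemeasurable hf.aestronglyMeasurable,
    integral_uniformFin]

lemma empiricalLaw_comp_perm {n : ℕ} (x : Fin (n + 1) → ℝ) (σ : Equiv.Perm (Fin (n + 1))) :
    empiricalLaw (x ∘ σ) = empiricalLaw x := by
  have hσ : Measure.map σ (uniformFin n : Measure (Fin (n + 1))) = uniformFin n := by
    refine Measure.ext_of_lintegral _ fun f hf => ?_
    rw [lintegral_map hf (measurable_of_finite σ)]
    change ∫⁻ a, f (σ a) ∂(PMF.uniformOfFintype (Fin (n + 1))).toMeasure =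
      ∫⁻ a, f a ∂(PMF.uniformOfFintype (Fin (n + 1))).toMeasure
    simpa [lintegral_fintype] using Equiv.sum_comp σ fun a => f a * ((n : ℝ≥0∞) + 1)⁻¹
  apply Subtype.ext
  change Measure.map (x ∘ σ) (uniformFin n : Measure (Fin (n + 1))) =
    Measure.map x (uniformFin n : Measure (Fin (n + 1)))
  rw [← Measure.map_map (measurable_of_finite x) (measurable_of_finite σ), hσ]

lemma integral_minLaw_empiricalLaw {n : ℕ} (x : Fin (n + 1) → ℝ) (k : ℕ) {g : ℝ → ℝ}
    (hg : Measurable g) :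
    ∫ y, g y ∂(minLaw (empiricalLaw x) k : Measure ℝ) =
      ((n : ℝ) + 1)⁻¹ * ∑ m : Fin (n + 1), g (x (Tuple.sort x m)) *
        frakS (k + 1) (((n + 1 - m : ℕ) : ℝ) / (n + 1)) (((n - m : ℕ) : ℝ) / (n + 1)) := by
  have hz := measurable_of_finite (x ∘ Tuple.sort x)
  rw [← empiricalLaw_comp_perm x (Tuple.sort x), empiricalLaw,
    ← map_minLaw (uniformFin n) (Tuple.monotone_sort x) hz k]
  change ∫ y, g y ∂((minLaw (uniformFin n) k : Measure (Fin (n + 1))).map _) = _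
  rw [integral_map hz.aemeasurable hg.aestronglyMeasurable, integral_minLaw, integral_uniformFin]
  simp_rw [← Finset.coe_Ici, ← Finset.coe_Ioi, uniformFin_apply]
  simp

lemma abs_integral_minLaw_empiricalLaw_sub_le {n : ℕ} (x : Fin (n + 1) → ℝ) (k : ℕ) {g : ℝ → ℝ}
    (hg : Measurable g) {C : ℝ} (hC : ∀ y, |g y| ≤ C) :
    |((n : ℝ) + 1)⁻¹ * ∑ i, g (x i) *
        (((n + 1 - rank (n + 1) x i : ℕ) : ℝ) / (n + 1)) ^ k -
      ((k : ℝ) + 1)⁻¹ * ∫ y, g y ∂(minLaw (empiricalLaw x) k : Measure ℝ)| ≤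
      C * k * ((n : ℝ) + 1)⁻¹ := by
  have hn : (0 : ℝ) < n + 1 := by positivity
  have hk : (0 : ℝ) < k + 1 := by positivity
  rw [integral_minLaw_empiricalLaw x k hg, ← Equiv.sum_comp (Tuple.sort x)]
  simp_rw [rank_sort, Nat.add_sub_add_right]
  rw [mul_left_comm, ← mul_sub, Finset.mul_sum, ← Finset.sum_sub_distrib, abs_mul,
    abs_of_pos (inv_pos.2 hn), mul_comm, ← div_eq_mul_inv, div_le_iff₀ hn]
  refine (Finset.abs_sum_le_sum_abs _ _).trans ?_
  have hterm : ∀ m : Fin (n + 1), |g (x (Tuple.sort x m)) * (((n - m : ℕ) : ℝ) / (n + 1)) ^ k -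
      ((k : ℝ) + 1)⁻¹ * (g (x (Tuple.sort x m)) * frakS (k + 1)
        (((n + 1 - m : ℕ) : ℝ) / (n + 1)) (((n - m : ℕ) : ℝ) / (n + 1)))| ≤
      C * (k * ((n : ℝ) + 1)⁻¹) := by
    intro m
    have hm : (m : ℕ) ≤ n := Nat.lt_succ_iff.1 m.2
    set s : ℝ := ((n + 1 - m : ℕ) : ℝ) / (n + 1) with hs
    set t : ℝ := ((n - m : ℕ) : ℝ) / (n + 1) with ht
    have hst : s - t = ((n : ℝ) + 1)⁻¹ := by
      rw [hs, ht, Nat.cast_sub (by omega), Nat.cast_sub hm]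
      push_cast
      field_simp
      ring
    have ht0 : 0 ≤ t := by positivity
    have hs1 : s ≤ 1 := by
      rw [hs, div_le_one hn]
      exact_mod_cast Nat.sub_le (n + 1) m
    have hb := abs_frakS_sub_le k ht0 (by have := inv_pos.2 hn; linarith) hs1
    rw [hst] at hb
    have heq : g (x (Tuple.sort x m)) * t ^ k -
        ((k : ℝ) + 1)⁻¹ * (g (x (Tuple.sort x m)) * frakS (k + 1) s t) =
        -(g (x (Tuple.sort x m)) * (((k : ℝ) + 1)⁻¹ * (frakS (k + 1) s t - (k + 1) * t ^ k))) := by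
      field_simp
      ring
    rw [heq, abs_neg, abs_mul, abs_mul, abs_of_pos (inv_pos.2 hk)]
    refine mul_le_mul (hC _) ?_ (by positivity) ((abs_nonneg _).trans (hC 0))
    rwa [inv_mul_le_iff₀ hk]
  refine (Finset.sum_le_sum fun m _ => hterm m).trans (le_of_eq ?_)
  simp
  field_simp

/-- Convergence of the rank-interaction sums: if the empirical measures of
`x^n ∈ [0,∞)^n` converge weakly to a Borel probability measure `μ` on `[0,∞)`, then for
every continuous compactly supported `g`,
`n⁻¹ Σ_i g(x^n_i)((n − rank(i;x^n))/n)^{ℓ−1} →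
  ℓ⁻¹ ∫ g(x) 𝔖(μ[x,∞), μ(x,∞)) dμ(x)`. -/
theorem rank_interaction_sum_tendsto
    (ℓ : ℕ) (hℓ : 2 ≤ ℓ)
    (x : (n : ℕ) → Fin n → ℝ) (hx : ∀ n i, 0 ≤ x n i)
    (μ : Measure ℝ) [IsProbabilityMeasure μ] (hμ : μ (Iio 0) = 0)
    (hconv : ∀ h : ℝ → ℝ, Continuous h → (∃ C : ℝ, ∀ y, |h y| ≤ C) →
      Tendsto (fun n : ℕ => (n : ℝ)⁻¹ * ∑ i : Fin n, h (x n i))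
        atTop (nhds (∫ y, h y ∂μ)))
    (g : ℝ → ℝ) (hg : Continuous g) (hgsupp : HasCompactSupport g) :
    Tendsto
      (fun n : ℕ => (n : ℝ)⁻¹ * ∑ i : Fin n,
        g (x n i) * (((n - rank n (x n) i : ℕ) : ℝ) / (n : ℝ)) ^ (ℓ - 1))
      atTop
      (nhds ((ℓ : ℝ)⁻¹ *
        ∫ y, g y * frakS ℓ (μ (Ici y)).toReal (μ (Ioi y)).toReal ∂μ)) := by
  obtain ⟨k, rfl⟩ : ∃ k, ℓ = k + 1 := ⟨ℓ - 1, by omega⟩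
  obtain ⟨C, hC⟩ : ∃ C, ∀ y, |g y| ≤ C := by
    simpa using hgsupp.exists_bound_of_continuous hg
  rw [← tendsto_add_atTop_iff_nat 1]
  simp only [Nat.add_sub_cancel, Nat.cast_add, Nat.cast_one]
  let P : ProbabilityMeasure ℝ := ⟨μ, inferInstance⟩
  have hP : Tendsto (fun n => empiricalLaw (x (n + 1))) atTop (𝓝 P) := by
    rw [ProbabilityMeasure.tendsto_iff_forall_integral_tendsto]
    intro h
    have := (tendsto_add_atTop_iff_nat 1).2
      (hconv h h.continuous ⟨‖h‖, fun y => h.norm_coe_le_norm y⟩)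
    simp only [Nat.cast_add, Nat.cast_one] at this
    simp only [integral_empiricalLaw _ h.continuous.measurable]
    exact this
  let G : BoundedContinuousFunction ℝ ℝ := .ofNormedAddCommGroup g hg C hC
  have hlim : Tendsto (fun n => ((k : ℝ) + 1)⁻¹ *
      ∫ y, g y ∂(minLaw (empiricalLaw (x (n + 1))) k : Measure ℝ)) atTop
      (𝓝 (((k : ℝ) + 1)⁻¹ * ∫ y, g y ∂(minLaw P k : Measure ℝ))) :=
    (ProbabilityMeasure.tendsto_iff_forall_integral_tendsto.1
      (((continuous_minLaw k).tendsto P).comp hP) G).const_mul _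
  rw [integral_minLaw] at hlim
  refine tendsto_of_tendsto_of_dist hlim (squeeze_zero (fun _ => dist_nonneg) (fun n => ?_)
    (by simpa using (tendsto_one_div_add_atTop_nhds_zero_nat (𝕜 := ℝ)).const_mul (C * k)))
  rw [dist_comm, Real.dist_eq]
  exact abs_integral_minLaw_empiricalLaw_sub_le (x (n + 1)) k hg.measurable hC
end
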